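/- arXiv:2310.02010 — 2 statements merged into one kernel-verified Lean document; each statement's English description precedes it below -/
import Mathlib

section
/- Every prime ideal of C_c(X)_F that is not a maximal ideal is an essential ideal of C_c(X)_F. -/
/-- The ring `C_c(X)_F` of real valued functions on `X` with countable range whose
set of points of discontinuity is finite, as a subring of `X → ℝ`. -/
def CcF (X : Type*) [TopologicalSpace X] : Subring (X → ℝ) where
  carrier := {f : X → ℝ | (Set.range f).Countable ∧ {x : X | ¬ ContinuousAt f x}.Finite}
  zero_mem' :=
    ⟨(Set.countable_singleton (0 : ℝ)).mono (Set.range_subset_iff.mpr fun _ => Set.mem_singleton _),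
      Set.finite_empty.subset fun x hx => (hx continuousAt_const).elim⟩
  one_mem' :=
    ⟨(Set.countable_singleton (1 : ℝ)).mono (Set.range_subset_iff.mpr fun _ => Set.mem_singleton _),
      Set.finite_empty.subset fun x hx => (hx continuousAt_const).elim⟩
  add_mem' := fun {f g} hf hg =>
    ⟨(Set.Countable.image2 hf.1 hg.1 (· + ·)).mono
        (by rintro - ⟨x, rfl⟩
            exact Set.mem_image2_of_mem (Set.mem_range_self x) (Set.mem_range_self x)),
      (hf.2.union hg.2).subset (by
        intro x hx
        by_contra h
        simp only [Set.mem_union, Set.mem_setOf_eq, not_or, not_not] at h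
        exact hx (h.1.add h.2))⟩
  neg_mem' := fun {f} hf =>
    ⟨(hf.1.image (fun t => -t)).mono
        (by rintro - ⟨x, rfl⟩; exact ⟨f x, Set.mem_range_self x, rfl⟩),
      hf.2.subset (by
        intro x hx
        by_contra h
        simp only [Set.mem_setOf_eq, not_not] at h
        exact hx h.neg)⟩
  mul_mem' := fun {f g} hf hg =>
    ⟨(Set.Countable.image2 hf.1 hg.1 (· * ·)).mono
        (by rintro - ⟨x, rfl⟩
            exact Set.mem_image2_of_mem (Set.mem_range_self x) (Set.mem_range_self x)),
      (hf.2.union hg.2).subset (by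
        intro x hx
        by_contra h
        simp only [Set.mem_union, Set.mem_setOf_eq, not_or, not_not] at h
        exact hx (h.1.mul h.2))⟩

/-- The zero set `Z(f)` of `f ∈ C_c(X)_F`. -/
def zSet {X : Type*} [TopologicalSpace X] (f : CcF X) : Set X := {x : X | (f : X → ℝ) x = 0}

/-- Two subsets `A`, `B` of `X` are `F_c`-completely separated if some `f ∈ C_c(X)_F`
is `0` on `A` and `1` on `B`. -/
def FcCompletelySeparated (X : Type*) [TopologicalSpace X] (A B : Set X) : Prop :=
  ∃ f : CcF X, (∀ a ∈ A, (f : X → ℝ) a = 0) ∧ (∀ b ∈ B, (f : X → ℝ) b = 1)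

/-- The function with value `c` at `x` and `0` elsewhere, as an element of `C_c(X)_F`. -/
noncomputable def CcF.single {X : Type*} [TopologicalSpace X] [T1Space X] (x : X) (c : ℝ) :
    CcF X := by
  classical
  exact ⟨Pi.single x c, by
    constructor
    · refine (Set.toFinite ({c, 0} : Set ℝ)).countable.mono ?_
      rintro - ⟨y, rfl⟩
      by_cases h : y = x
      · subst h
        simp
      · simp [h]
    · refine (Set.finite_singleton x).subset fun y hy => ?_
      by_contra h
      refine hy (continuousAt_const (y := (0 : ℝ)) |>.congr ?_)
      filter_upwards [isOpen_compl_singleton.mem_nhds h] with z hz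
      simp [show z ≠ x from hz]⟩

namespace CcF

variable {X : Type*} [TopologicalSpace X] [T1Space X]

@[simp]
theorem single_same (x : X) (c : ℝ) : (single x c : X → ℝ) x = c := by
  simp [single]

theorem single_of_ne {x y : X} (h : y ≠ x) (c : ℝ) : (single x c : X → ℝ) y = 0 := by
  simp [single, h]

/-- A proper ideal containing `1 - χ_{x}` is maximal. -/
theorem isMaximal_of_one_sub_single_mem {P : Ideal (CcF X)} (hP : P ≠ ⊤) {x : X}
    (hx : 1 - single x 1 ∈ P) : P.IsMaximal := by
  refine Ideal.isMaximal_iff.mpr ⟨(Ideal.ne_top_iff_one P).mp hP, fun J f hPJ hfP hfJ => ?_⟩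
  have hf : (f : X → ℝ) x ≠ 0 := by
    intro h0
    refine hfP ?_
    have : f = f * (1 - single x 1) := by
      ext y
      by_cases h : y = x
      · subst h
        simp [h0]
      · simp [single_of_ne h]
    rw [this]
    exact P.mul_mem_left _ hx
  have : (1 : CcF X) = (1 - single x 1) + single x ((f : X → ℝ) x)⁻¹ * f := by
    ext y
    by_cases h : y = x
    · subst h
      simp [hf]
    · simp [single_of_ne h]
  rw [this]
  exact J.add_mem (hPJ hx) (J.mul_mem_left _ hfJ)

/-- A prime ideal that is not maximal contains the indicator of every point. -/
theorem single_mem_of_not_isMaximal {P : Ideal (CcF X)} (hP : P.IsPrime)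
    (hnotmax : ¬ P.IsMaximal) (x : X) : single x 1 ∈ P := by
  refine (hP.mem_or_mem (y := 1 - single x 1) ?_).resolve_right fun h =>
    hnotmax (isMaximal_of_one_sub_single_mem hP.ne_top h)
  have : single x 1 * (1 - single x 1) = 0 := by
    ext y
    by_cases h : y = x
    · subst h
      simp
    · simp [single_of_ne h]
  rw [this]
  exact P.zero_mem

end CcF

theorem stmt12 {X : Type*} [TopologicalSpace X] [T1Space X] (P : Ideal (CcF X))
    (hP : P.IsPrime) (hnotmax : ¬ P.IsMaximal) :
    P ≠ ⊥ ∧ ∀ J : Ideal (CcF X), J ≠ ⊥ → P ⊓ J ≠ ⊥ := by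
  have key : ∀ J : Ideal (CcF X), J ≠ ⊥ → P ⊓ J ≠ ⊥ := by
    intro J hJ hPJ
    obtain ⟨f, hfJ, hf⟩ := Submodule.exists_mem_ne_zero_of_ne_bot hJ
    refine hf (Subtype.ext (funext fun x => ?_))
    have hmem : f * CcF.single x 1 ∈ P ⊓ J :=
      ⟨P.mul_mem_left _ (CcF.single_mem_of_not_isMaximal hP hnotmax x), J.mul_mem_right _ hfJ⟩
    rw [hPJ, Ideal.mem_bot] at hmem
    simpa using congrFun (congrArg Subtype.val hmem) x
  refine ⟨fun h => key ⊤ (fun htop => hP.ne_top (top_le_iff.mp (htop ▸ bot_le))) ?_, key⟩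
  rw [h, bot_inf_eq]
end

section
/- C_c(X)_F = C_c(X) if and only if X is a discrete space; that is, every function f : X → ℝ with countable range whose set of discontinuity points is finite is continuous if and only if every point of X is isolated. -/
/-- The indicator function of a point of a T₁ space has countable range and is discontinuous
at most at that point. -/
theorem indicator_singleton_mem_CcF {X : Type*} [TopologicalSpace X] [T1Space X] (x : X) :
    Set.indicator {x} (fun _ => (1 : ℝ)) ∈ CcF X := by
  refine ⟨(Set.toFinite {(0 : ℝ), 1}).countable.mono ?_, (Set.finite_singleton x).subset ?_⟩
  · rintro - ⟨y, rfl⟩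
    by_cases h : y = x <;> simp [h]
  · intro y hy
    by_contra h
    refine hy ((continuousAt_const (y := (0 : ℝ))).congr ?_)
    filter_upwards [isOpen_compl_singleton.mem_nhds h] with z hz
    exact (Set.indicator_of_notMem hz _).symm

theorem stmt15 {X : Type*} [TopologicalSpace X] [T1Space X] :
    (∀ f : CcF X, Continuous (f : X → ℝ)) ↔ DiscreteTopology X := by
  refine ⟨fun h => discreteTopology_iff_isOpen_singleton.mpr fun x => ?_,
    fun _ _ => continuous_of_discreteTopology⟩
  convert isOpen_compl_singleton.preimage (h ⟨_, indicator_singleton_mem_CcF x⟩)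
    (t := {(0 : ℝ)}ᶜ)
  ext y
  by_cases hy : y = x <;> simp [hy]
end
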